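/- For any integer m ≥ 0 and 0 < |q| < 1, writing τ(n) = (−1)^n q^{n(n−1)/2}: ∑_{n=0}^{m} (q^n − 1) τ(n)² τ(n−m) (q^{m−n+1}; q)_{2n} / (q;q)_{2n} equals (1 − q^L) q^{3L² + L} if m = 3L, equals (q^{2L+1} − 1) q^{3L² + 2L} if m = 3L+1, and equals (1 − q^{L+1}) q^{3L² + 4L + 1} if m = 3L+2. -/

import Mathlib

noncomputable def qp (q x : ℂ) (n : ℕ) : ℂ := ∏ i ∈ Finset.range n, (1 - x * q ^ i)

/-- The truncated sum `∑_{n=0}^{m} (q^n − 1) τ(n)² τ(n−m) (q^{m−n+1};q)_{2n} / (q;q)_{2n}`. -/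
noncomputable def S11 (q : ℂ) (m : ℕ) : ℂ :=
  ∑ n ∈ Finset.range (m + 1),
    (q ^ n - 1) * q ^ (n * (n - 1)) *
      ((-1 : ℂ) ^ ((n : ℤ) - m) * q ^ (((n : ℤ) - m) * ((n : ℤ) - m - 1) / 2)) *
      qp q (q ^ ((m : ℤ) - n + 1)) (2 * n) / qp q q (2 * n)

noncomputable def ff (q : ℂ) (m n : ℕ) : ℂ :=
  q ^ (n * (n - 1)) *
      ((-1 : ℂ) ^ ((n : ℤ) - m) * q ^ (((n : ℤ) - m) * ((n : ℤ) - m - 1) / 2)) *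
      qp q (q ^ ((m : ℤ) - n + 1)) (2 * n) / qp q q (2 * n)

lemma tau_succ (q : ℂ) (hq : q ≠ 0) (k : ℤ) :
    (-1 : ℂ) ^ (k + 1) * q ^ ((k + 1) * (k + 1 - 1) / 2)
      = - q ^ k * ((-1 : ℂ) ^ k * q ^ (k * (k - 1) / 2)) := by
  have h : (k + 1) * (k + 1 - 1) / 2 = k * (k - 1) / 2 + k := by
    rw [← Int.add_mul_ediv_right _ _ (by norm_num : (2 : ℤ) ≠ 0)]
    congr 1
    ring
  rw [h, zpow_add₀ hq, zpow_add₀ (by norm_num : (-1 : ℂ) ≠ 0)]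
  simp
  ring

lemma qp_succ (q x : ℂ) (n : ℕ) : qp q x (n + 1) = qp q x n * (1 - x * q ^ n) := by
  simp [qp, Finset.prod_range_succ]

lemma qp_succ' (q x : ℂ) (n : ℕ) : qp q x (n + 1) = (1 - x) * qp q (x * q) n := by
  simp only [qp, Finset.prod_range_succ']
  rw [mul_comm]
  congr 1
  · simp
  · apply Finset.prod_congr rfl
    intro i _
    ring

lemma one_sub_ne (q : ℂ) (h1 : ‖q‖ < 1) (k : ℕ) : 1 - q ^ (k + 1) ≠ 0 := by
  intro h
  have h2 : q ^ (k + 1) = 1 := (sub_eq_zero.mp h).symm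
  have h3 : ‖q‖ ^ (k + 1) = 1 := by rw [← norm_pow, h2]; simp
  have := pow_lt_one₀ (norm_nonneg q) h1 (Nat.succ_ne_zero k)
  exact absurd h3 (ne_of_lt this)

lemma one_add_ne (q : ℂ) (h1 : ‖q‖ < 1) (k : ℕ) : 1 + q ^ (k + 1) ≠ 0 := by
  intro h
  have h2 : q ^ (k + 1) = -1 := by linear_combination h
  have h3 : ‖q‖ ^ (k + 1) = 1 := by rw [← norm_pow, h2]; simp
  have := pow_lt_one₀ (norm_nonneg q) h1 (Nat.succ_ne_zero k)
  exact absurd h3 (ne_of_lt this)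

lemma qpq_ne (q : ℂ) (h1 : ‖q‖ < 1) (k : ℕ) : qp q q k ≠ 0 := by
  rw [qp, Finset.prod_ne_zero_iff]
  intro i _
  have := one_sub_ne q h1 i
  rwa [pow_succ'] at this

lemma ff_m (q : ℂ) (hq : q ≠ 0) (m n : ℕ) :
    ff q (m + 1) n * (q ^ n - q ^ m * q) = - (q ^ m * q) * (1 - q ^ m * q ^ n * q) * ff q m n := by
  have ht := tau_succ q hq ((n : ℤ) - (m + 1 : ℕ))
  rw [show (n : ℤ) - (m + 1 : ℕ) + 1 = n - m by push_cast; ring] at ht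
  have e1 := qp_succ q (q ^ ((m : ℤ) - n + 1)) (2 * n)
  rw [qp_succ'] at e1
  have e2 : q ^ ((m : ℤ) - n + 1) * q = q ^ (((m + 1 : ℕ) : ℤ) - n + 1) := by
    rw [← zpow_add_one₀ hq]; congr 1; push_cast; ring
  rw [e2] at e1
  unfold ff
  rw [ht]
  set T := (-1 : ℂ) ^ ((n : ℤ) - (m + 1 : ℕ)) *
    q ^ (((n : ℤ) - (m + 1 : ℕ)) * ((n : ℤ) - (m + 1 : ℕ) - 1) / 2) with hT
  set Q1 := qp q (q ^ (((m + 1 : ℕ) : ℤ) - n + 1)) (2 * n)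
  set Q0 := qp q (q ^ ((m : ℤ) - n + 1)) (2 * n)
  have e3 : q ^ ((m : ℤ) - n + 1) = q ^ m * q / q ^ n := by
    rw [zpow_add_one₀ hq, zpow_sub₀ hq]; simp; ring
  have e4 : q ^ ((n : ℤ) - (m + 1 : ℕ)) = q ^ n / (q ^ m * q) := by
    rw [zpow_sub₀ hq, zpow_natCast, zpow_natCast, pow_succ]
  rw [e3] at e1
  rw [e4]
  have hn : q ^ n ≠ 0 := pow_ne_zero _ hq
  have hm : q ^ m ≠ 0 := pow_ne_zero _ hq
  have e5 : (q ^ n - q ^ m * q) * Q1 = q ^ n * (Q0 * (1 - q ^ m * q ^ n * q)) := by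
    have : q ^ m * q / q ^ n * q ^ (2 * n) = q ^ m * q ^ n * q := by
      rw [show q ^ (2 * n) = (q ^ n) ^ 2 by ring]
      field_simp
    rw [this] at e1
    rw [← e1]
    field_simp
  calc _ = q ^ (n * (n - 1)) * T * ((q ^ n - q ^ m * q) * Q1) / qp q q (2 * n) := by ring
    _ = _ := by
      rw [e5]
      field_simp

lemma ff_n (q : ℂ) (hq : q ≠ 0) (h1 : ‖q‖ < 1) (m n : ℕ) :
    q ^ m * (1 - q * (q ^ n) ^ 2) * (1 - q ^ 2 * (q ^ n) ^ 2) * ff q m (n + 1)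
      = - (q ^ n) ^ 2 * (q ^ n - q ^ m) * (1 - q ^ m * q ^ n * q) * ff q m n := by
  have ht := tau_succ q hq ((n : ℤ) - m)
  rw [show (n : ℤ) - m + 1 = (n + 1 : ℕ) - m by push_cast; ring] at ht
  have e1 := qp_succ' q (q ^ ((m : ℤ) - (n + 1 : ℕ) + 1)) (2 * n + 1)
  have e2 : q ^ ((m : ℤ) - (n + 1 : ℕ) + 1) * q = q ^ ((m : ℤ) - n + 1) := by
    rw [← zpow_add_one₀ hq]; congr 1; push_cast; ring
  rw [e2, qp_succ q (q ^ ((m : ℤ) - n + 1))] at e1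
  have hn : q ^ n ≠ 0 := pow_ne_zero _ hq
  have hm : q ^ m ≠ 0 := pow_ne_zero _ hq
  have e3 : q ^ ((m : ℤ) - n + 1) = q ^ m * q / q ^ n := by
    rw [zpow_add_one₀ hq, zpow_sub₀ hq]; simp; ring
  have e4 : q ^ ((m : ℤ) - (n + 1 : ℕ) + 1) = q ^ m / q ^ n := by
    rw [show (m : ℤ) - (n + 1 : ℕ) + 1 = m - n by push_cast; ring, zpow_sub₀ hq]; simp
  have e6 : q ^ ((n : ℤ) - m) = q ^ n / q ^ m := by
    rw [zpow_sub₀ hq]; simp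
  have e7 : q ^ ((n + 1) * (n + 1 - 1)) = q ^ (n * (n - 1)) * (q ^ n) ^ 2 := by
    rw [← pow_mul, ← pow_add]
    congr 1
    cases n with
    | zero => simp
    | succ k => simp; ring
  have e8 : qp q q (2 * n + 1 + 1)
      = qp q q (2 * n) * ((1 - q * (q ^ n) ^ 2) * (1 - q ^ 2 * (q ^ n) ^ 2)) := by
    rw [qp_succ, qp_succ]; ring
  have h8 := qpq_ne q h1 (2 * n + 1 + 1)
  have h9 := qpq_ne q h1 (2 * n)
  unfold ff
  rw [show 2 * (n + 1) = 2 * n + 1 + 1 by ring, ht, e7, e1, e6, e4]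
  set T := (-1 : ℂ) ^ ((n : ℤ) - m) *
    q ^ (((n : ℤ) - m) * ((n : ℤ) - m - 1) / 2) with hT
  set Q0 := qp q (q ^ ((m : ℤ) - n + 1)) (2 * n)
  rw [e3]
  have : q ^ m * q / q ^ n * q ^ (2 * n) = q ^ m * q ^ n * q := by
    rw [show q ^ (2 * n) = (q ^ n) ^ 2 by ring]
    field_simp
  rw [this]
  rw [e8] at h8 ⊢
  have h10 := right_ne_zero_of_mul h8
  have h11 := left_ne_zero_of_mul h10
  have h12 := right_ne_zero_of_mul h10
  generalize 1 - q * (q ^ n) ^ 2 = u at *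
  generalize 1 - q ^ 2 * (q ^ n) ^ 2 = v at *
  generalize qp q q (2 * n) = w at *
  field_simp
  try ring

lemma ff_zero (q : ℂ) (hq : q ≠ 0) (m n : ℕ) (h : m < n) : ff q m n = 0 := by
  have : qp q (q ^ ((m : ℤ) - n + 1)) (2 * n) = 0 := by
    rw [qp, Finset.prod_eq_zero_iff]
    refine ⟨n - m - 1, by simp; omega, ?_⟩
    rw [← zpow_natCast, ← zpow_add₀ hq]
    have : (m : ℤ) - n + 1 + ((n - m - 1 : ℕ) : ℤ) = 0 := by omega
    rw [this]; simp
  simp [ff, this]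

/-- certificate -/
noncomputable def gg (q : ℂ) (m n : ℕ) : ℂ :=
  - ff q (m + 3) n * (1 - (q ^ n) ^ 2) * (1 - (q ^ n) ^ 2 / q) * (1 - q ^ 4 * (q ^ m) ^ 2)
    / ((1 - q ^ m * q ^ n * q) * (1 - q ^ m * q ^ n * q ^ 2) * (1 - q ^ m * q ^ n * q ^ 3))

lemma key (q : ℂ) (hq : q ≠ 0) (h1 : ‖q‖ < 1) (m n : ℕ) :
    (q ^ n * ff q (m + 3) n - q ^ 4 * (q ^ m) ^ 2 * (q ^ n * ff q m n)
      = q ^ (n + 1) * gg q m (n + 1) - q ^ n * gg q m n) ∧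
    ((1 + q ^ 3 * (q ^ m) ^ 2) * ff q (m + 3) n
      + (q ^ m) ^ 2 * q ^ 3 * (1 - q ^ 2) * (ff q (m + 1) n - ff q (m + 2) n)
      - q ^ 3 * (q ^ m) ^ 2 * (1 + q ^ 5 * (q ^ m) ^ 2) * ff q m n
      = (1 + q ^ 4 * (q ^ m) ^ 2 + q ^ m * (1 - q) * q ^ (n + 1)) * gg q m (n + 1)
        - (1 + q ^ 4 * (q ^ m) ^ 2 + q ^ m * (1 - q) * q ^ n) * gg q m n) := by
  have a0 := ff_m q hq m n
  have a1 := ff_m q hq (m + 1) n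
  have a2 := ff_m q hq (m + 2) n
  have a3 := ff_n q hq h1 (m + 3) n
  have hn : q ^ n ≠ 0 := pow_ne_zero _ hq
  have hm : q ^ m ≠ 0 := pow_ne_zero _ hq
  have d1 : 1 - q ^ m * q ^ n * q ≠ 0 := by
    convert one_sub_ne q h1 (m + n) using 2; ring
  have d2 : 1 - q ^ m * q ^ n * q ^ 2 ≠ 0 := by
    convert one_sub_ne q h1 (m + n + 1) using 2; ring
  have d3 : 1 - q ^ m * q ^ n * q ^ 3 ≠ 0 := by
    convert one_sub_ne q h1 (m + n + 2) using 2; ring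
  have d4 : 1 - q ^ m * q ^ n * q ^ 4 ≠ 0 := by
    convert one_sub_ne q h1 (m + n + 3) using 2; ring
  have c1 : 1 - q * (q ^ n) ^ 2 ≠ 0 := by
    convert one_sub_ne q h1 (2 * n) using 2; ring
  have c2 : 1 - q ^ 2 * (q ^ n) ^ 2 ≠ 0 := by
    convert one_sub_ne q h1 (2 * n + 1) using 2; ring
  unfold gg
  rw [pow_succ q n]
  rw [pow_add q m 1] at a1
  rw [pow_add q m 2] at a2
  rw [pow_add q m 3] at a3
  rw [show m + 1 + 1 = m + 2 from rfl] at a1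
  rw [show m + 2 + 1 = m + 3 from rfl] at a2
  generalize q ^ n = t at *
  generalize q ^ m = x at *
  generalize ff q (m + 3) (n + 1) = f3' at *
  generalize ff q (m + 3) n = f3 at *
  generalize ff q (m + 2) n = f2 at *
  generalize ff q (m + 1) n = f1 at *
  generalize ff q m n = f0 at *
  have b2 : f2 = - f3 * (t - x * q ^ 3) / (x * q ^ 3 * (1 - x * t * q ^ 3)) := by
    rw [eq_div_iff (by positivity)]
    linear_combination a2
  have b1 : f1 = - f2 * (t - x * q ^ 2) / (x * q ^ 2 * (1 - x * t * q ^ 2)) := by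
    rw [eq_div_iff (by positivity)]
    linear_combination a1
  have b0 : f0 = - f1 * (t - x * q) / (x * q * (1 - x * t * q)) := by
    rw [eq_div_iff (by positivity)]
    linear_combination a0
  have b3 : f3' = - t ^ 2 * (t - x * q ^ 3) * (1 - x * t * q ^ 4) * f3 /
      (x * q ^ 3 * (1 - q * t ^ 2) * (1 - q ^ 2 * t ^ 2)) := by
    rw [eq_div_iff (by positivity)]
    linear_combination a3
  have d2' : 1 - x * (t * q) * q ≠ 0 := by convert d2 using 2; ring
  have d3' : 1 - x * (t * q) * q ^ 2 ≠ 0 := by convert d3 using 2; ring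
  have d4' : 1 - x * (t * q) * q ^ 3 ≠ 0 := by convert d4 using 2; ring
  have g1 : -f3' * (1 - (t * q) ^ 2) * (1 - (t * q) ^ 2 / q) * (1 - q ^ 4 * x ^ 2) /
        ((1 - x * (t * q) * q) * (1 - x * (t * q) * q ^ 2) * (1 - x * (t * q) * q ^ 3))
      = t ^ 2 * (t - x * q ^ 3) * f3 * (1 - q ^ 4 * x ^ 2) /
        (x * q ^ 3 * (1 - x * t * q ^ 2) * (1 - x * t * q ^ 3)) := by
    rw [show 1 - (t * q) ^ 2 / q = 1 - q * t ^ 2 by field_simp,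
      show 1 - (t * q) ^ 2 = 1 - q ^ 2 * t ^ 2 by ring,
      show 1 - x * (t * q) * q = 1 - x * t * q ^ 2 by ring,
      show 1 - x * (t * q) * q ^ 2 = 1 - x * t * q ^ 3 by ring,
      show 1 - x * (t * q) * q ^ 3 = 1 - x * t * q ^ 4 by ring, b3]
    clear * - c1 c2 d2 d3 d4 hq hm
    generalize 1 - q * t ^ 2 = u at *
    generalize 1 - q ^ 2 * t ^ 2 = v at *
    generalize 1 - x * t * q ^ 2 = u2 at *
    generalize 1 - x * t * q ^ 3 = u3 at *
    generalize 1 - x * t * q ^ 4 = u4 at *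
    field_simp
  rw [g1, b0, b1, b2]
  clear * - d1 d2 d3 hq hm
  obtain ⟨u1, h1⟩ : ∃ u, u = 1 - x * t * q := ⟨_, rfl⟩
  obtain ⟨u2, h2⟩ : ∃ u, u = 1 - x * t * q ^ 2 := ⟨_, rfl⟩
  obtain ⟨u3, h3⟩ : ∃ u, u = 1 - x * t * q ^ 3 := ⟨_, rfl⟩
  rw [← h1] at d1 ⊢
  rw [← h2] at d2 ⊢
  rw [← h3] at d3 ⊢
  constructor
  · field_simp
    rw [h1, h2, h3]
    ring
  · field_simp
    rw [h1, h2, h3]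
    ring

noncomputable def AA (q : ℂ) (m : ℕ) : ℂ := ∑ n ∈ Finset.range (m + 1), q ^ n * ff q m n
noncomputable def BB (q : ℂ) (m : ℕ) : ℂ := ∑ n ∈ Finset.range (m + 1), ff q m n

lemma S_eq (q : ℂ) (m : ℕ) : S11 q m = AA q m - BB q m := by
  rw [S11, AA, BB, ← Finset.sum_sub_distrib]
  apply Finset.sum_congr rfl
  intro n _
  rw [ff]; ring

lemma AA_ext (q : ℂ) (hq : q ≠ 0) (m N : ℕ) (h : m + 1 ≤ N) :
    AA q m = ∑ n ∈ Finset.range N, q ^ n * ff q m n := by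
  apply Finset.sum_subset (by simpa using h)
  intro n _ h2
  rw [ff_zero q hq m n (by simpa using h2), mul_zero]

lemma BB_ext (q : ℂ) (hq : q ≠ 0) (m N : ℕ) (h : m + 1 ≤ N) :
    BB q m = ∑ n ∈ Finset.range N, ff q m n := by
  apply Finset.sum_subset (by simpa using h)
  intro n _ h2
  rw [ff_zero q hq m n (by simpa using h2)]

lemma gg_zero (q : ℂ) (m : ℕ) : gg q m 0 = 0 := by simp [gg]
lemma gg_top (q : ℂ) (hq : q ≠ 0) (m : ℕ) : gg q m (m + 4) = 0 := by
  simp [gg, ff_zero q hq (m + 3) (m + 4) (by omega)]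

lemma AA_rec (q : ℂ) (hq : q ≠ 0) (h1 : ‖q‖ < 1) (m : ℕ) :
    AA q (m + 3) = q ^ 4 * (q ^ m) ^ 2 * AA q m := by
  have := Finset.sum_congr (rfl : Finset.range (m + 4) = _) (fun n _ => (key q hq h1 m n).1)
  rw [Finset.sum_range_sub (fun n => q ^ n * gg q m n), gg_zero, gg_top q hq,
    Finset.sum_sub_distrib, ← Finset.mul_sum, ← AA_ext q hq (m + 3) _ le_rfl,
    ← AA_ext q hq m _ (by omega)] at this
  linear_combination this

lemma BB_rec (q : ℂ) (hq : q ≠ 0) (h1 : ‖q‖ < 1) (m : ℕ) :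
    (1 + q ^ 3 * (q ^ m) ^ 2) * BB q (m + 3)
      + (q ^ m) ^ 2 * q ^ 3 * (1 - q ^ 2) * (BB q (m + 1) - BB q (m + 2))
      - q ^ 3 * (q ^ m) ^ 2 * (1 + q ^ 5 * (q ^ m) ^ 2) * BB q m = 0 := by
  have := Finset.sum_congr (rfl : Finset.range (m + 4) = _) (fun n _ => (key q hq h1 m n).2)
  rw [Finset.sum_range_sub
    (fun n => (1 + q ^ 4 * (q ^ m) ^ 2 + q ^ m * (1 - q) * q ^ n) * gg q m n), gg_zero,
    gg_top q hq, Finset.sum_sub_distrib, Finset.sum_add_distrib, ← Finset.mul_sum,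
    ← Finset.mul_sum, ← Finset.mul_sum, Finset.sum_sub_distrib,
    ← BB_ext q hq (m + 3) _ le_rfl, ← BB_ext q hq (m + 2) _ (by omega),
    ← BB_ext q hq (m + 1) _ (by omega), ← BB_ext q hq m _ (by omega)] at this
  linear_combination this

lemma base (q : ℂ) (hq : q ≠ 0) (h1 : ‖q‖ < 1) :
    ff q 0 0 = 1 ∧ ff q 1 0 = -q ∧ ff q 1 1 = 1 ∧ ff q 2 0 = q ^ 3 ∧
    ff q 2 1 = - q * (1 + q + q ^ 2) ∧ ff q 2 2 = q ^ 2 := by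
  have h00 : ff q 0 0 = 1 := by simp [ff, qp]
  have a0 := ff_m q hq 0 0
  have a1 := ff_m q hq 1 0
  have a2 := ff_n q hq h1 1 0
  have a3 := ff_n q hq h1 2 0
  have a4 := ff_n q hq h1 2 1
  have k1 := one_sub_ne q h1 0
  have k2 := one_sub_ne q h1 1
  have k3 := one_sub_ne q h1 2
  have k4 := one_sub_ne q h1 3
  norm_num at *
  rw [h00] at a0
  have h10 : ff q 1 0 = -q := by
    apply mul_right_cancel₀ k1; linear_combination a0
  rw [h10] at a1 a2
  have h20 : ff q 2 0 = q ^ 3 := by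
    apply mul_right_cancel₀ k2; linear_combination a1
  rw [h20] at a3
  have h11 : ff q 1 1 = 1 := by
    apply mul_left_cancel₀ (mul_ne_zero hq (mul_ne_zero k1 k2)); linear_combination a2
  have h21 : ff q 2 1 = - q * (1 + q + q ^ 2) := by
    apply mul_left_cancel₀ (mul_ne_zero (pow_ne_zero 2 hq) (mul_ne_zero k1 k2))
    linear_combination a3
  rw [h21] at a4
  have h22 : ff q 2 2 = q ^ 2 := by
    apply mul_left_cancel₀ (mul_ne_zero (pow_ne_zero 2 hq) (mul_ne_zero k3 k4))
    linear_combination a4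
  refine ⟨h00, h10, h11, h20, ?_, h22⟩
  rw [h21]; ring

lemma AA_val (q : ℂ) (hq : q ≠ 0) (h1 : ‖q‖ < 1) (L : ℕ) :
    AA q (3 * L) = q ^ (3 * L ^ 2 + L) ∧ AA q (3 * L + 1) = 0 ∧
    AA q (3 * L + 2) = - q ^ (3 * L ^ 2 + 5 * L + 2) := by
  induction L with
  | zero =>
    obtain ⟨b1, b2, b3, b4, b5, b6⟩ := base q hq h1
    simp only [AA, Finset.sum_range_succ, Finset.sum_range_zero, mul_zero, zero_add, b1, b2, b3,
      b4, b5, b6]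
    refine ⟨by simp, by ring, by ring⟩
  | succ L ih =>
    obtain ⟨i0, i1, i2⟩ := ih
    have r0 := AA_rec q hq h1 (3 * L)
    have r1 := AA_rec q hq h1 (3 * L + 1)
    have r2 := AA_rec q hq h1 (3 * L + 2)
    rw [i0] at r0
    rw [i1] at r1
    rw [i2] at r2
    refine ⟨?_, ?_, ?_⟩
    · rw [show 3 * (L + 1) = 3 * L + 3 by ring, r0]; ring
    · rw [show 3 * (L + 1) + 1 = 3 * L + 1 + 3 by ring, r1]; ring
    · rw [show 3 * (L + 1) + 2 = 3 * L + 2 + 3 by ring, r2]; ring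

lemma BB_val (q : ℂ) (hq : q ≠ 0) (h1 : ‖q‖ < 1) (L : ℕ) :
    BB q (3 * L) = q ^ (3 * L ^ 2 + 2 * L) ∧
    BB q (3 * L + 1) = q ^ (3 * L ^ 2 + 2 * L) - q ^ (3 * L ^ 2 + 4 * L + 1) ∧
    BB q (3 * L + 2) = - q ^ (3 * L ^ 2 + 4 * L + 1) := by
  induction L with
  | zero =>
    obtain ⟨b1, b2, b3, b4, b5, b6⟩ := base q hq h1
    simp only [BB, Finset.sum_range_succ, Finset.sum_range_zero, mul_zero, zero_add, b1, b2, b3,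
      b4, b5, b6]
    refine ⟨by simp, by ring, by ring⟩
  | succ L ih =>
    obtain ⟨i0, i1, i2⟩ := ih
    have r0 := BB_rec q hq h1 (3 * L)
    have r1 := BB_rec q hq h1 (3 * L + 1)
    have r2 := BB_rec q hq h1 (3 * L + 2)
    have dd : ∀ m : ℕ, 1 + q ^ 3 * (q ^ m) ^ 2 ≠ 0 := by
      intro m
      convert one_add_ne q h1 (2 * m + 2) using 2; ring
    have j0 : BB q (3 * L + 3) = q ^ (3 * (L + 1) ^ 2 + 2 * (L + 1)) := by
      rw [i0, i1, i2] at r0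
      apply mul_left_cancel₀ (dd (3 * L))
      linear_combination r0
    have j1 : BB q (3 * L + 4) = q ^ (3 * (L + 1) ^ 2 + 2 * (L + 1))
        - q ^ (3 * (L + 1) ^ 2 + 4 * (L + 1) + 1) := by
      rw [show 3 * L + 1 + 3 = 3 * L + 4 by ring, show 3 * L + 1 + 1 = 3 * L + 2 by ring,
        show 3 * L + 1 + 2 = 3 * L + 3 by ring, i1, i2, j0] at r1
      apply mul_left_cancel₀ (dd (3 * L + 1))
      linear_combination r1
    have j2 : BB q (3 * L + 5) = - q ^ (3 * (L + 1) ^ 2 + 4 * (L + 1) + 1) := by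
      rw [show 3 * L + 2 + 3 = 3 * L + 5 by ring, show 3 * L + 2 + 1 = 3 * L + 3 by ring,
        show 3 * L + 2 + 2 = 3 * L + 4 by ring, i2, j0, j1] at r2
      apply mul_left_cancel₀ (dd (3 * L + 2))
      linear_combination r2
    exact ⟨j0, j1, j2⟩

theorem stmt11 (q : ℂ) (h0 : 0 < ‖q‖) (h1 : ‖q‖ < 1) (L : ℕ) :
    S11 q (3 * L) = (1 - q ^ L) * q ^ (3 * L ^ 2 + L)
    ∧ S11 q (3 * L + 1) = (q ^ (2 * L + 1) - 1) * q ^ (3 * L ^ 2 + 2 * L)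
    ∧ S11 q (3 * L + 2) = (1 - q ^ (L + 1)) * q ^ (3 * L ^ 2 + 4 * L + 1) := by
  have hq : q ≠ 0 := norm_pos_iff.mp h0
  obtain ⟨a0, a1, a2⟩ := AA_val q hq h1 L
  obtain ⟨b0, b1, b2⟩ := BB_val q hq h1 L
  rw [S_eq, S_eq, S_eq, a0, a1, a2, b0, b1, b2]
  refine ⟨by ring, by ring, by ring⟩
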